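/- arXiv:1205.3416 — 2 statements merged into one kernel-verified Lean document; each statement's English description precedes it below -/
import Mathlib

section
/- Let G = Z_p ⋊ Z_d be a semidirect product of cyclic groups, where p is a prime, d is a divisor of p−1, and Z_d acts faithfully (via conjugation) on Z_p. Suppose F is algebraically closed of characteristic not dividing |G| = pd. Then σ(G) = p; that is, σ(G,V) ≤ p for every G-module V, and there exists a G-module V with σ(G,V) = p. -/
open scoped ENNReal


open MvPolynomial

/-- The (right) action of a group element `g` on the coordinate ring `F[V]` of `V = ι → F`,
determined by `(f^g)(v) = f (g • v)` where `g` acts on `V` through the representation `ρ`. -/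
noncomputable def polyAct {F : Type*} [Field F] {G : Type*} [Group G] {ι : Type*}
    [Fintype ι] [DecidableEq ι] (ρ : Representation F G (ι → F)) (g : G) :
    MvPolynomial ι F →ₐ[F] MvPolynomial ι F :=
  MvPolynomial.aeval (fun i => ∑ j, (ρ g (Pi.single j 1) i) • MvPolynomial.X j)

/-- The ring of polynomial invariants `F[V]^G`. -/
noncomputable def invRing {F : Type*} [Field F] {G : Type*} [Group G] {ι : Type*}
    [Fintype ι] [DecidableEq ι] (ρ : Representation F G (ι → F)) :
    Subalgebra F (MvPolynomial ι F) :=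
  ⨅ g : G, AlgHom.equalizer (polyAct ρ g) (AlgHom.id F (MvPolynomial ι F))

/-- The degree `d` homogeneous component of a graded subalgebra `S` of the polynomial ring,
as a subspace of the polynomial ring. -/
noncomputable def subComp {F : Type*} [Field F] {ι : Type*} (S : Subalgebra F (MvPolynomial ι F)) (d : ℕ) :
    Submodule F (MvPolynomial ι F) :=
  Subalgebra.toSubmodule S ⊓ homogeneousSubmodule ι F d

/-- `S_+`, the span of the homogeneous elements of positive degree of `S`. -/
noncomputable def subPos {F : Type*} [Field F] {ι : Type*} (S : Subalgebra F (MvPolynomial ι F)) :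
    Submodule F (MvPolynomial ι F) :=
  ⨆ d ∈ Set.Ioi (0 : ℕ), subComp S d

/-- `β_k(S)`, the top degree of `S_+ / S_+^{k+1}`, i.e. the supremum (in `ℕ∞`) of the degrees `d`
such that the degree `d` component of `S_+` is not contained in `S_+^{k+1}`. -/
noncomputable def betaAlg {F : Type*} [Field F] {ι : Type*}
    (S : Subalgebra F (MvPolynomial ι F)) (k : ℕ) : ℕ∞ :=
  sSup ((fun d : ℕ => (d : ℕ∞)) '' {d | 0 < d ∧ ¬ subComp S d ≤ subPos S ^ (k + 1)})

/-- `β_k(F[V], S)`, the top degree of `F[V]/S_+^k F[V]`, i.e. the supremum (in `ℕ∞`) of the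
degrees `d` such that the degree `d` component of the polynomial ring is not contained in
`S_+^k ⬝ F[V]`. -/
noncomputable def betaMod {F : Type*} [Field F] {ι : Type*}
    (S : Subalgebra F (MvPolynomial ι F)) (k : ℕ) : ℕ∞ :=
  sSup ((fun d : ℕ => (d : ℕ∞)) ''
    {d | ¬ homogeneousSubmodule ι F d ≤ subPos S ^ k * (⊤ : Submodule F (MvPolynomial ι F))})

/-- `β_k(G)`, the supremum over all finite dimensional `G`-modules `V` of `β_k(F[V]^G)`. -/
noncomputable def betaGrp (F : Type*) [Field F] (G : Type*) [Group G] (k : ℕ) : ℕ∞ :=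
  ⨆ (n : ℕ) (ρ : Representation F G (Fin n → F)), betaAlg (invRing ρ) k

/-- `S` is a finitely generated module over its subalgebra `T`. -/
noncomputable def fgOver {F : Type*} [Field F] {ι : Type*} (S T : Subalgebra F (MvPolynomial ι F)) : Prop :=
  ∃ B : Finset (MvPolynomial ι F), (B : Set (MvPolynomial ι F)) ⊆ S ∧
    Subalgebra.toSubmodule S ≤ Subalgebra.toSubmodule T * Submodule.span F (B : Set (MvPolynomial ι F))

/-- `σ(S)`: the minimal `d` such that `S` is a finitely generated module over the subalgebra
`F[S_{≤ d}]` generated by the homogeneous elements of `S` of degree at most `d`. -/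
noncomputable def sigmaAlg {F : Type*} [Field F] {ι : Type*}
    (S : Subalgebra F (MvPolynomial ι F)) : ℕ :=
  sInf {d : ℕ | fgOver S (Algebra.adjoin F (⋃ i ∈ Set.Iic d, (subComp S i : Set (MvPolynomial ι F))))}

/-- `σ(G)`, the supremum over all finite dimensional `G`-modules `V` of `σ(F[V]^G)`. -/
noncomputable def sigmaGrp (F : Type*) [Field F] (G : Type*) [Group G] : ℕ∞ :=
  ⨆ (n : ℕ) (ρ : Representation F G (Fin n → F)), (sigmaAlg (invRing ρ) : ℕ∞)

/-- An irreducible (simple, nonzero) representation. -/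
def IsIrredRep {F : Type*} [Field F] {G : Type*} [Group G] {V : Type*}
    [AddCommGroup V] [Module F V] (π : Representation F G V) : Prop :=
  Nontrivial V ∧ ∀ W : Submodule F V, (∀ g : G, ∀ x ∈ W, π g x ∈ W) → W = ⊥ ∨ W = ⊤


section Basics

variable {F : Type*} [Field F] {G : Type*} [Group G] {n : ℕ}

lemma eval_polyAct (ρ : Representation F G (Fin n → F)) (g : G) (f : MvPolynomial (Fin n) F)
    (u : Fin n → F) : eval u (polyAct ρ g f) = eval (ρ g u) f := by
  have h : ((aeval u : MvPolynomial (Fin n) F →ₐ[F] F).comp (polyAct ρ g))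
      = (aeval (ρ g u) : MvPolynomial (Fin n) F →ₐ[F] F) := by
    apply MvPolynomial.algHom_ext
    intro i
    simp only [polyAct, AlgHom.comp_apply, aeval_X, map_sum, map_smul, smul_eq_mul]
    conv_rhs => rw [← LinearMap.sum_single_apply (v := u)]
    simp only [map_sum, Finset.sum_apply]
    refine Finset.sum_congr rfl fun j _ => ?_
    have h2 : (Pi.single j (u j) : Fin n → F) = u j • (Pi.single j (1 : F) : Fin n → F) := by
      simp [← Pi.single_smul]
    rw [h2, map_smul]; simp [mul_comm]
  have := DFunLike.congr_fun h f
  simpa [aeval_eq_eval] using this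

lemma mem_invRing_iff [Infinite F] (ρ : Representation F G (Fin n → F))
    (f : MvPolynomial (Fin n) F) :
    f ∈ invRing ρ ↔ ∀ g u, eval (ρ g u) f = eval u f := by
  simp only [invRing, Algebra.mem_iInf, AlgHom.mem_equalizer, AlgHom.id_apply]
  constructor
  · intro h g u
    rw [← eval_polyAct, h g]
  · intro h g
    apply MvPolynomial.funext
    intro u
    rw [eval_polyAct, h]

lemma polyAct_homog (ρ : Representation F G (Fin n → F)) (g : G) {f : MvPolynomial (Fin n) F}
    {k : ℕ} (hf : f.IsHomogeneous k) : (polyAct ρ g f).IsHomogeneous k := by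
  have := hf.aeval (fun i => ∑ j, (ρ g (Pi.single j 1) i) • (X j : MvPolynomial (Fin n) F)) (n := 1)
    (fun i => IsHomogeneous.sum _ _ _ fun j _ => by
      rw [smul_eq_C_mul]; exact isHomogeneous_C_mul_X _ _)
  rw [one_mul] at this
  exact this

/-- The averaging operator. -/
noncomputable def reyn [Fintype G] (ρ : Representation F G (Fin n → F)) :
    MvPolynomial (Fin n) F →ₗ[F] MvPolynomial (Fin n) F :=
  (Fintype.card G : F)⁻¹ • ∑ g : G, (polyAct ρ g).toLinearMap

lemma eval_reyn [Fintype G] (ρ : Representation F G (Fin n → F)) (f : MvPolynomial (Fin n) F)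
    (u : Fin n → F) :
    eval u (reyn ρ f) = (Fintype.card G : F)⁻¹ * ∑ g : G, eval (ρ g u) f := by
  simp [reyn, smul_eval, LinearMap.sum_apply, map_sum, eval_polyAct]

lemma reyn_mem [Infinite F] [Fintype G] (ρ : Representation F G (Fin n → F))
    (f : MvPolynomial (Fin n) F) : reyn ρ f ∈ invRing ρ := by
  rw [mem_invRing_iff]
  intro g u
  rw [eval_reyn, eval_reyn]
  congr 1
  refine Fintype.sum_equiv (Equiv.mulRight g) _ _ fun h => ?_
  simp [map_mul]

lemma reyn_mul [Infinite F] [Fintype G] (ρ : Representation F G (Fin n → F))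
    (t f : MvPolynomial (Fin n) F) (ht : t ∈ invRing ρ) : reyn ρ (t * f) = t * reyn ρ f := by
  rw [mem_invRing_iff] at ht
  apply MvPolynomial.funext
  intro u
  simp only [eval_mul, eval_reyn, ht, ← Finset.mul_sum]
  ring

lemma reyn_self [Infinite F] [Fintype G] (hG : (Fintype.card G : F) ≠ 0)
    (ρ : Representation F G (Fin n → F))
    (f : MvPolynomial (Fin n) F) (ht : f ∈ invRing ρ) : reyn ρ f = f := by
  rw [mem_invRing_iff] at ht
  apply MvPolynomial.funext
  intro u
  simp only [eval_reyn, ht]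
  simp [hG]

/-- graded Nakayama -/
lemma nakayama (T : Subalgebra F (MvPolynomial (Fin n) F)) (A : Set (MvPolynomial (Fin n) F))
    (hA : ∀ a ∈ A, a ∈ T ∧ ∃ k, 0 < k ∧ a.IsHomogeneous k) (D : ℕ)
    (hD : idealOfVars (Fin n) F ^ D ≤ Ideal.span A) :
    (⊤ : Submodule F (MvPolynomial (Fin n) F)) ≤
      Subalgebra.toSubmodule T * ⨆ i ∈ Finset.range D, homogeneousSubmodule (Fin n) F i := by
  set M := Subalgebra.toSubmodule T * ⨆ i ∈ Finset.range D, homogeneousSubmodule (Fin n) F i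
    with hM
  have hTM : ∀ t ∈ T, ∀ m ∈ M, t * m ∈ M := by
    intro t ht m hm
    have h1 : t * m ∈ Subalgebra.toSubmodule T * M := Submodule.mul_mem_mul ht hm
    rwa [hM, ← mul_assoc, (Subalgebra.isIdempotentElem_toSubmodule T).eq] at h1
  have key : ∀ e : ℕ, ∀ f : MvPolynomial (Fin n) F, f.IsHomogeneous e → f ∈ M := by
    intro e
    induction e using Nat.strong_induction_on with
    | _ e ih =>
    intro f hf
    by_cases he : e < D
    · have h1 : (1 : MvPolynomial (Fin n) F) * f ∈ M := by
        refine Submodule.mul_mem_mul (Subalgebra.one_mem T) ?_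
        exact (le_iSup₂_of_le (f := fun i (_ : i ∈ Finset.range D) ↦
          homogeneousSubmodule (Fin n) F i) e (Finset.mem_range.2 he) le_rfl) hf
      simpa using h1
    · have hfA : f ∈ Ideal.span A := by
        apply hD
        rw [mem_pow_idealOfVars_iff']
        intro x hx
        apply hf.coeff_eq_zero
        omega
      have : ∀ h, homogeneousComponent e (h * f) ∈ M := by
        refine Submodule.span_induction (p := fun f _ => ∀ h, homogeneousComponent e (h * f) ∈ M)
          ?_ ?_ ?_ ?_ hfA
        · intro a ha h
          obtain ⟨haT, k, hk, hak⟩ := hA a ha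
          rw [← sum_homogeneousComponent h, Finset.sum_mul, map_sum]
          refine Submodule.sum_mem _ fun i _ => ?_
          have hh := (homogeneousComponent_isHomogeneous i h).mul hak
          rw [homogeneousComponent_of_mem hh]
          split_ifs with hik
          · rw [mul_comm]
            exact hTM _ haT _ (ih i (by omega) _ (homogeneousComponent_isHomogeneous i h))
          · exact Submodule.zero_mem _
        · intro h; simp
        · intro x y _ _ hx hy h
          rw [mul_add, map_add]; exact Submodule.add_mem _ (hx h) (hy h)
        · intro a x _ hx h
          rw [smul_eq_mul, ← mul_assoc]; exact hx _
      have h1 := this 1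
      rwa [one_mul, homogeneousComponent_eq_self hf] at h1
  intro f _
  rw [← sum_homogeneousComponent f]
  exact Submodule.sum_mem _ fun i _ => key i _ (homogeneousComponent_isHomogeneous i f)

lemma fgOver_of_sep [IsAlgClosed F] [Fintype G] (hG : (Fintype.card G : F) ≠ 0)
    (ρ : Representation F G (Fin n → F)) (p : ℕ)
    (hsep : ∀ v : Fin n → F, v ≠ 0 → ∃ k, 0 < k ∧ k ≤ p ∧ ∃ f ∈ subComp (invRing ρ) k,
      eval v f ≠ 0) :
    fgOver (invRing ρ) (Algebra.adjoin F
      (⋃ i ∈ Set.Iic p, (subComp (invRing ρ) i : Set (MvPolynomial (Fin n) F)))) := by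
  have : Infinite F := IsAlgClosed.instInfinite
  set T := Algebra.adjoin F
      (⋃ i ∈ Set.Iic p, (subComp (invRing ρ) i : Set (MvPolynomial (Fin n) F))) with hT
  have hTS : T ≤ invRing ρ := by
    apply Algebra.adjoin_le
    intro f hf
    simp only [Set.mem_iUnion] at hf
    obtain ⟨i, _, hf⟩ := hf
    exact hf.1
  set A : Set (MvPolynomial (Fin n) F) :=
    {f | ∃ k, 0 < k ∧ k ≤ p ∧ f ∈ subComp (invRing ρ) k} with hAdef
  have hA : ∀ a ∈ A, a ∈ T ∧ ∃ k, 0 < k ∧ a.IsHomogeneous k := by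
    rintro a ⟨k, hk, hkp, ha⟩
    refine ⟨Algebra.subset_adjoin ?_, k, hk, ha.2⟩
    simp only [Set.mem_iUnion]
    exact ⟨k, hkp, ha⟩
  have hrad : idealOfVars (Fin n) F ≤ (Ideal.span A).radical := by
    rw [← vanishingIdeal_zeroLocus_eq_radical (K := F), idealOfVars, Ideal.span_le]
    rintro _ ⟨i, rfl⟩
    rw [SetLike.mem_coe, mem_vanishingIdeal_iff]
    intro v hv
    rw [zeroLocus_span] at hv
    have : v = 0 := by
      by_contra hv0
      obtain ⟨k, hk, hkp, f, hf, hfv⟩ := hsep v hv0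
      exact hfv (by simpa [aeval_eq_eval] using hv f ⟨k, hk, hkp, hf⟩)
    simp [this]
  obtain ⟨D, hD⟩ := Ideal.exists_pow_le_of_le_radical_of_fg hrad (IsNoetherian.noetherian _)
  have hN := nakayama T A hA D hD
  have hfg : (⨆ i ∈ Finset.range D, homogeneousSubmodule (Fin n) F i).FG :=
    Submodule.fg_biSup _ _ fun i _ => homogeneousSubmodule_fg _ _ i
  obtain ⟨B0, hB0⟩ := hfg
  rw [← hB0] at hN
  classical
  refine ⟨B0.image (reyn ρ), ?_, ?_⟩
  · intro f hf
    simp only [Finset.coe_image, Set.mem_image] at hf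
    obtain ⟨b, _, rfl⟩ := hf
    exact reyn_mem ρ b
  · intro s hs
    have hs' : s ∈ invRing ρ := hs
    rw [← reyn_self hG ρ s hs', Finset.coe_image, ← Submodule.map_span]
    refine Submodule.mul_induction_on (hN (Submodule.mem_top (x := s)))
      (C := fun s => reyn ρ s ∈ _) ?_ ?_
    · intro t ht b hb
      rw [reyn_mul ρ t b (hTS ht)]
      exact Submodule.mul_mem_mul ht (Submodule.mem_map_of_mem hb)
    · intro x y hx hy
      rw [map_add]; exact Submodule.add_mem _ hx hy

end Basics

section Comb

open scoped Pointwise in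
lemma nfold_sums {p : ℕ} (hp : p.Prime) {B : Type*} [Fintype B] [DecidableEq B]
    (χ : B → ZMod p) (hχ : Function.Injective χ) (hχ0 : ∀ b, χ b ≠ 0) (S : Finset B) (N : ℕ) :
    ∃ E : Finset (ZMod p), E.Nonempty ∧ min p (N * S.card + 1) ≤ E.card ∧
      ∀ x ∈ E, ∃ e : B → ℕ, (∀ b, b ∉ S → e b = 0) ∧ ∑ b, e b ≤ N ∧
        ∑ b, (e b : ZMod p) * χ b = x := by
  induction N with
  | zero =>
    refine ⟨{0}, by simp, by simp, ?_⟩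
    intro x hx
    refine ⟨fun _ => 0, by simp, by simp, ?_⟩
    simp only [Finset.mem_singleton] at hx
    simp [hx]
  | succ N ih =>
    obtain ⟨E, hE, hcard, hx⟩ := ih
    have hT : (insert 0 (S.image χ)).card = S.card + 1 := by
      rw [Finset.card_insert_of_notMem, Finset.card_image_of_injective _ hχ]
      simp only [Finset.mem_image, not_exists, not_and]
      intro b _
      exact hχ0 b
    refine ⟨E + insert 0 (S.image χ), hE.add (Finset.insert_nonempty _ _), ?_, ?_⟩
    · have h1 := ZMod.cauchy_davenport hp hE (Finset.insert_nonempty 0 (S.image χ))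
      rw [hT] at h1
      have h2 : (N + 1) * S.card = N * S.card + S.card := by ring
      rw [h2]
      omega
    · intro x hxm
      obtain ⟨y, hy, z, hz, rfl⟩ := Finset.mem_add.1 hxm
      obtain ⟨e, he0, heN, hes⟩ := hx y hy
      rw [Finset.mem_insert] at hz
      rcases hz with rfl | hz
      · exact ⟨e, he0, by omega, by simpa using hes⟩
      · obtain ⟨s, hs, rfl⟩ := Finset.mem_image.1 hz
        refine ⟨fun b => e b + if b = s then 1 else 0, ?_, ?_, ?_⟩
        · intro b hb
          have : b ≠ s := fun h => hb (h ▸ hs)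
          simp [he0 b hb, this]
        · simp only [Finset.sum_add_distrib, Finset.sum_ite_eq', Finset.mem_univ, if_true]
          omega
        · simp [add_mul, Finset.sum_add_distrib, hes]

lemma exists_exps {p : ℕ} (hp : p.Prime) {B : Type*} [Fintype B] [DecidableEq B]
    (χ : B → ZMod p) (hχ : Function.Injective χ) (hχ0 : ∀ b, χ b ≠ 0) (S : Finset B)
    (hS : S.Nonempty) (hcard : S.card ≤ p - 1) :
    ∃ e : B → ℕ, (∀ b, e b ≠ 0 ↔ b ∈ S) ∧ ∑ b, e b ≤ p ∧
        ∑ b, (e b : ZMod p) * χ b = 0 := by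
  have : NeZero p := ⟨hp.ne_zero⟩
  obtain ⟨E, -, hE, hx⟩ := nfold_sums hp χ hχ hχ0 S (p - S.card)
  have hk := hS.card_pos
  have hp2 := hp.two_le
  have hEp : E = Finset.univ := by
    apply Finset.eq_univ_of_card
    rw [ZMod.card]
    apply le_antisymm
    · simpa [ZMod.card] using Finset.card_le_univ E
    · refine le_trans (le_min le_rfl ?_) hE
      obtain ⟨a, ha⟩ : ∃ a, S.card = a + 1 := ⟨S.card - 1, by omega⟩
      obtain ⟨b, hb⟩ : ∃ b, p = a + 1 + (b + 1) := ⟨p - (a + 1) - 1, by omega⟩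
      have : p - S.card = b + 1 := by omega
      rw [this, ha, hb]
      nlinarith [Nat.zero_le (a * b)]
  obtain ⟨e, he0, heN, hes⟩ := hx (-∑ b ∈ S, χ b) (hEp ▸ Finset.mem_univ _)
  refine ⟨fun b => e b + if b ∈ S then 1 else 0, ?_, ?_, ?_⟩
  · intro b
    by_cases hb : b ∈ S
    · simp [hb]
    · simp [hb, he0 b hb]
  · simp only [Finset.sum_add_distrib, Finset.sum_ite_mem, Finset.univ_inter, Finset.sum_const,
      smul_eq_mul, mul_one]
    omega
  · have : ∀ b, ((e b + if b ∈ S then 1 else 0 : ℕ) : ZMod p) * χ b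
        = e b * χ b + if b ∈ S then χ b else 0 := by
      intro b; split_ifs <;> simp [add_mul]
    simp only [this, Finset.sum_add_distrib, hes, Finset.sum_ite_mem, Finset.univ_inter]
    simp

end Comb

section Key

variable {p d : ℕ} (φ : Multiplicative (ZMod d) →* MulAut (Multiplicative (ZMod p)))

/-- The multiplier by which `b` acts on `ZMod p`. -/
def chiMul (b : Multiplicative (ZMod d)) : ZMod p :=
  Multiplicative.toAdd (φ b (Multiplicative.ofAdd 1))

lemma phi_apply [NeZero p] (b : Multiplicative (ZMod d)) (a : ZMod p) :
    φ b (Multiplicative.ofAdd a) = Multiplicative.ofAdd (a * chiMul φ b) := by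
  have h1 : Multiplicative.ofAdd a = (Multiplicative.ofAdd (1 : ZMod p)) ^ a.val := by
    rw [← ofAdd_nsmul]; simp
  rw [h1, map_pow]
  apply Multiplicative.toAdd.injective
  rw [toAdd_pow, toAdd_ofAdd]
  simp [chiMul]

lemma chiMul_mul [NeZero p] (b c : Multiplicative (ZMod d)) :
    chiMul φ (b * c) = chiMul φ b * chiMul φ c := by
  have h : chiMul φ (b * c) = Multiplicative.toAdd (φ b (φ c (Multiplicative.ofAdd 1))) := by
    simp [chiMul]
  rw [h, phi_apply φ c, phi_apply φ b]
  simp [mul_comm]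

lemma chiMul_one [NeZero p] : chiMul φ 1 = 1 := by
  simp [chiMul]

lemma chiMul_inj [NeZero p] (hφ : Function.Injective φ) : Function.Injective (chiMul φ) := by
  intro b c h
  apply hφ
  ext a
  have h1 := phi_apply φ b (Multiplicative.toAdd a)
  have h2 := phi_apply φ c (Multiplicative.toAdd a)
  rw [h, ← h2] at h1
  simpa using h1

lemma chiMul_ne_zero [NeZero p] [Fact p.Prime] (b : Multiplicative (ZMod d)) :
    chiMul φ b ≠ 0 := by
  intro h
  have := chiMul_mul φ b b⁻¹
  rw [h, zero_mul, mul_inv_cancel, chiMul_one] at this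
  exact one_ne_zero this

lemma exists_char (F : Type*) [Field F] [IsAlgClosed F] [NeZero p] (hF : (p : F) ≠ 0) :
    ∃ ψ : AddChar (ZMod p) F, ψ.IsPrimitive := by
  have : NeZero (p : F) := ⟨hF⟩
  obtain ⟨ζ, hζ⟩ := HasEnoughRootsOfUnity.exists_primitiveRoot F p
  exact ⟨_, AddChar.zmodChar_primitive_of_primitive_root p hζ⟩

open scoped Pointwise in
lemma key_sep {F : Type*} [Field F] [IsAlgClosed F] (hp : p.Prime) (hd : d ∣ p - 1)
    (hφ : Function.Injective φ) (hF : ((p * d : ℕ) : F) ≠ 0) {n : ℕ}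
    (ρ : Representation F (Multiplicative (ZMod p) ⋊[φ] Multiplicative (ZMod d)) (Fin n → F))
    (v : Fin n → F) (hv : v ≠ 0) :
    ∃ k, 0 < k ∧ k ≤ p ∧ ∃ f ∈ subComp (invRing ρ) k, eval v f ≠ 0 := by
  classical
  have : Infinite F := IsAlgClosed.instInfinite
  have : NeZero p := ⟨hp.ne_zero⟩
  have : Fact p.Prime := ⟨hp⟩
  have hpF : (p : F) ≠ 0 := by intro h; apply hF; simp [h]
  have hdF : (d : F) ≠ 0 := by intro h; apply hF; simp [h]
  have hd0 : d ≠ 0 := by rintro rfl; simp at hdF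
  have : NeZero d := ⟨hd0⟩
  have hdp : d ≤ p - 1 := Nat.le_of_dvd (by have := hp.two_le; omega) hd
  obtain ⟨ψ, hψ⟩ := exists_char F hpF
  let a_ : ZMod p → Multiplicative (ZMod p) ⋊[φ] Multiplicative (ZMod d) :=
    fun a => SemidirectProduct.inl (Multiplicative.ofAdd a)
  let b_ : Multiplicative (ZMod d) → Multiplicative (ZMod p) ⋊[φ] Multiplicative (ZMod d) :=
    fun b => SemidirectProduct.inr b
  have a_add : ∀ x y, a_ (x + y) = a_ x * a_ y := by
    intro x y; simp [a_, ofAdd_add]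
  have a_zero : a_ 0 = 1 := by simp [a_]
  have b_mul : ∀ x y, b_ (x * y) = b_ x * b_ y := by
    intro x y; simp [b_]
  have ba : ∀ b a, b_ b * a_ a = a_ (a * chiMul φ b) * b_ b := by
    intro b a
    simp only [a_, b_]
    rw [← phi_apply φ b a, SemidirectProduct.inl_aut]
    simp
  obtain ⟨i, hi⟩ : ∃ i, v i ≠ 0 := by
    by_contra h; push Not at h; exact hv (funext h)
  -- the weight forms
  let l : ZMod p → MvPolynomial (Fin n) F := fun j =>
    ∑ a : ZMod p, C (ψ (-(a * j))) * polyAct ρ (a_ a) (X i)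
  have l_hom : ∀ j, (l j).IsHomogeneous 1 := fun j =>
    IsHomogeneous.sum _ _ _ fun a _ => (polyAct_homog ρ _ (isHomogeneous_X F i)).C_mul _
  have l_eval : ∀ j u, eval u (l j) = ∑ a : ZMod p, ψ (-(a * j)) * ρ (a_ a) u i := by
    intro j u
    simp [l, eval_polyAct]
  have l_wt : ∀ j a u, eval (ρ (a_ a) u) (l j) = ψ (a * j) * eval u (l j) := by
    intro j a u
    rw [l_eval, l_eval, Finset.mul_sum]
    refine Fintype.sum_equiv (Equiv.addRight a) _ _ fun c => ?_
    simp only [Equiv.coe_addRight, a_add, map_mul, Module.End.mul_apply]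
    rw [← mul_assoc, ← AddChar.map_add_eq_mul]
    congr 2
    ring
  have l_sum : ∑ j, eval v (l j) = p * v i := by
    simp only [l_eval]
    rw [Finset.sum_comm]
    simp only [← Finset.sum_mul]
    have : ∀ a : ZMod p, ∑ j : ZMod p, ψ (-(a * j)) = if a = 0 then (p : F) else 0 := by
      intro a
      have h := AddChar.sum_mulShift (-a) hψ
      rw [ZMod.card] at h
      simp only [neg_eq_zero, Nat.cast_ite, Nat.cast_zero] at h
      rw [← h]
      refine Finset.sum_congr rfl fun j _ => ?_
      congr 1; ring
    simp [this, a_zero]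
  obtain ⟨j, hj⟩ : ∃ j, eval v (l j) ≠ 0 := by
    by_contra h
    push Not at h
    rw [Finset.sum_eq_zero (fun j _ => h j)] at l_sum
    exact mul_ne_zero hpF hi l_sum.symm
  -- the induced coordinates
  let y : Multiplicative (ZMod d) → MvPolynomial (Fin n) F := fun b => polyAct ρ (b_ b) (l j)
  have y_hom : ∀ b, (y b).IsHomogeneous 1 := fun b => polyAct_homog ρ _ (l_hom j)
  have y_b : ∀ b c u, eval (ρ (b_ c) u) (y b) = eval u (y (b * c)) := by
    intro b c u
    simp only [y, eval_polyAct, b_mul, map_mul, Module.End.mul_apply]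
  have y_a : ∀ b a u, eval (ρ (a_ a) u) (y b) = ψ (a * chiMul φ b * j) * eval u (y b) := by
    intro b a u
    simp only [y, eval_polyAct]
    rw [← Module.End.mul_apply, ← map_mul, ba, map_mul, Module.End.mul_apply, l_wt]
  -- the support
  let S : Finset (Multiplicative (ZMod d)) := Finset.univ.filter fun b => eval v (y b) ≠ 0
  have memS : ∀ b, b ∈ S ↔ eval v (y b) ≠ 0 := by intro b; simp [S]
  have oneS : 1 ∈ S := by
    rw [memS]
    simpa [y, eval_polyAct, b_] using hj
  have cardB : Fintype.card (Multiplicative (ZMod d)) = d := by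
    rw [Fintype.card_multiplicative, ZMod.card]
  have Scard : S.card ≤ d := by
    exact (Finset.card_le_univ S).trans_eq cardB
  -- invariants from monomials
  let m : (Multiplicative (ZMod d) → ℕ) → MvPolynomial (Fin n) F := fun e => ∏ b, y b ^ e b
  let f : (Multiplicative (ZMod d) → ℕ) → MvPolynomial (Fin n) F := fun e =>
    ∑ c, polyAct ρ (b_ c) (m e)
  have m_hom : ∀ e, (m e).IsHomogeneous (∑ b, e b) := fun e =>
    IsHomogeneous.prod _ _ _ fun b _ => by simpa using (y_hom b).pow (e b)
  have f_hom : ∀ e, (f e).IsHomogeneous (∑ b, e b) := fun e =>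
    IsHomogeneous.sum _ _ _ fun c _ => polyAct_homog ρ _ (m_hom e)
  have m_a : ∀ e, (j * ∑ b, (e b : ZMod p) * chiMul φ b = 0) →
      ∀ a u, eval (ρ (a_ a) u) (m e) = eval u (m e) := by
    intro e he a u
    simp only [m, map_prod, map_pow, y_a, mul_pow, Finset.prod_mul_distrib]
    have : ∏ b, ψ (a * chiMul φ b * j) ^ e b = 1 := by
      simp only [← AddChar.map_nsmul_eq_pow]
      have hprod : ∀ (s : Finset (Multiplicative (ZMod d))) (g : Multiplicative (ZMod d) → ZMod p),
          ∏ b ∈ s, ψ (g b) = ψ (∑ b ∈ s, g b) := by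
        intro s g
        induction s using Finset.induction_on with
        | empty => simp
        | insert x s hx ih => rw [Finset.prod_insert hx, Finset.sum_insert hx, ih,
            AddChar.map_add_eq_mul]
      rw [hprod]
      have : ∑ b, e b • (a * chiMul φ b * j) = a * (j * ∑ b, (e b : ZMod p) * chiMul φ b) := by
        rw [Finset.mul_sum, Finset.mul_sum]
        refine Finset.sum_congr rfl fun b _ => ?_
        rw [nsmul_eq_mul]; ring
      rw [this, he, mul_zero, AddChar.map_zero_eq_one]
    rw [this, one_mul]
  have f_eval : ∀ e u, eval u (f e) = ∑ c, eval (ρ (b_ c) u) (m e) := by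
    intro e u
    simp [f, eval_polyAct]
  have f_inv : ∀ e, (j * ∑ b, (e b : ZMod p) * chiMul φ b = 0) → f e ∈ invRing ρ := by
    intro e he
    rw [mem_invRing_iff]
    have hA : ∀ a u, eval (ρ (a_ a) u) (f e) = eval u (f e) := by
      intro a u
      rw [f_eval, f_eval]
      refine Finset.sum_congr rfl fun c _ => ?_
      rw [← Module.End.mul_apply, ← map_mul, ba, map_mul, Module.End.mul_apply, m_a e he]
    have hB : ∀ b u, eval (ρ (b_ b) u) (f e) = eval u (f e) := by
      intro b u
      rw [f_eval, f_eval]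
      refine Fintype.sum_equiv (Equiv.mulRight b) _ _ fun c => ?_
      simp only [Equiv.coe_mulRight, b_mul, map_mul, Module.End.mul_apply]
    intro g u
    have hg : g = a_ (Multiplicative.toAdd g.left) * b_ g.right := by
      simp [a_, b_]
    rw [hg, map_mul, Module.End.mul_apply, hA, hB]
  have m_v : ∀ e c, eval (ρ (b_ c) v) (m e) = ∏ b, eval v (y (b * c)) ^ e b := by
    intro e c
    simp only [m, map_prod, map_pow, y_b]
  have m_v0 : ∀ e, (∀ b, e b ≠ 0 ↔ b ∈ S) → ∀ c, c • S ≠ S → eval (ρ (b_ c) v) (m e) = 0 := by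
    intro e he c hc
    rw [m_v]
    by_contra hne
    apply hc
    apply Finset.eq_of_subset_of_card_le
    · intro x hx
      obtain ⟨b, hb, rfl⟩ := Finset.mem_smul_finset.1 hx
      rw [memS, smul_eq_mul, mul_comm]
      intro h0
      apply hne
      apply Finset.prod_eq_zero (Finset.mem_univ b)
      rw [h0, zero_pow ((he b).2 hb)]
    · rw [Finset.card_smul_finset]
  have m_v1 : ∀ e, (∀ b, e b ≠ 0 ↔ b ∈ S) → eval v (m e) ≠ 0 := by
    intro e he
    simp only [m, map_prod, map_pow]
    rw [Finset.prod_ne_zero_iff]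
    intro b _
    by_cases hb : b ∈ S
    · exact pow_ne_zero _ ((memS b).1 hb)
    · have : e b = 0 := by by_contra h; exact hb ((he b).1 h)
      simp [this]
  have b_one : b_ 1 = 1 := by simp [b_]
  by_cases hcase : j * ∑ b ∈ S, chiMul φ b = 0
  · let e : Multiplicative (ZMod d) → ℕ := fun b => if b ∈ S then 1 else 0
    have he : ∀ b, e b ≠ 0 ↔ b ∈ S := by intro b; simp [e]
    have hesum : ∑ b, e b = S.card := by simp [e]
    refine ⟨∑ b, e b, ?_, ?_, f e, ⟨f_inv e ?_, f_hom e⟩, ?_⟩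
    · rw [hesum]; exact Finset.card_pos.2 ⟨1, oneS⟩
    · rw [hesum]; omega
    · simpa [e] using hcase
    · have hst : ∀ c, eval (ρ (b_ c) v) (m e)
          = if c ∈ MulAction.stabilizer (Multiplicative (ZMod d)) S then eval v (m e) else 0 := by
        intro c
        split_ifs with hc
        · rw [MulAction.mem_stabilizer_iff] at hc
          have h1 : ∀ c', eval (ρ (b_ c') v) (m e) = ∏ b ∈ c' • S, eval v (y b) := by
            intro c'
            rw [m_v, ← Finset.image_smul, Finset.prod_image (by intro x _ y _ h; simpa using h)]
            simp only [e, pow_ite, pow_one, pow_zero, Finset.prod_ite_mem, Finset.univ_inter,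
              smul_eq_mul]
            exact Finset.prod_congr rfl fun b _ => by rw [mul_comm]
          rw [h1, hc]
          have h2 := h1 1
          rw [one_smul, b_one, map_one, Module.End.one_apply] at h2
          exact h2.symm
        · exact m_v0 e he c hc
      rw [f_eval]
      simp only [hst]
      rw [Finset.sum_ite, Finset.sum_const_zero, add_zero, Finset.sum_const, nsmul_eq_mul]
      refine mul_ne_zero ?_ (m_v1 e he)
      have hc : (Finset.univ.filter fun c =>
          c ∈ MulAction.stabilizer (Multiplicative (ZMod d)) S).card ∣ d := by
        have := Subgroup.card_subgroup_dvd_card (MulAction.stabilizer (Multiplicative (ZMod d)) S)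
        rw [Nat.card_eq_fintype_card, Nat.card_eq_fintype_card, cardB, Fintype.card_subtype] at this
        exact this
      intro h0
      obtain ⟨q, hq⟩ := hc
      apply hdF
      rw [hq, Nat.cast_mul, h0, zero_mul]
  · obtain ⟨e, he, hep, hes⟩ := exists_exps hp (chiMul φ) (chiMul_inj φ hφ) (chiMul_ne_zero φ) S
      ⟨1, oneS⟩ (by omega)
    have hstab : ∀ c : Multiplicative (ZMod d), c ≠ 1 → c • S ≠ S := by
      intro c hc h
      apply hc
      apply chiMul_inj φ hφ
      rw [chiMul_one]
      have h1 : ∑ b ∈ c • S, chiMul φ b = chiMul φ c * ∑ b ∈ S, chiMul φ b := by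
        rw [← Finset.image_smul, Finset.sum_image (by intro x _ y _ h; simpa using h),
          Finset.mul_sum]
        exact Finset.sum_congr rfl fun b _ => by rw [smul_eq_mul, chiMul_mul]
      rw [h] at h1
      have h2 : ∑ b ∈ S, chiMul φ b ≠ 0 := right_ne_zero_of_mul hcase
      exact (mul_right_cancel₀ h2 (by rw [one_mul]; exact h1)).symm
    refine ⟨∑ b, e b, ?_, hep, f e, ⟨f_inv e (by rw [hes, mul_zero]), f_hom e⟩, ?_⟩
    · have h1 := (he 1).2 oneS
      have h2 : e 1 ≤ ∑ b, e b := Finset.single_le_sum (fun _ _ => Nat.zero_le _) (Finset.mem_univ 1)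
      omega
    · rw [f_eval, Finset.sum_eq_single 1]
      · rw [b_one, map_one, Module.End.one_apply]
        exact m_v1 e he
      · intro c _ hc
        exact m_v0 e he c (hstab c hc)
      · simp

end Key

section Lower

variable {p d : ℕ} (φ : Multiplicative (ZMod d) →* MulAut (Multiplicative (ZMod p)))

/-- The affine permutation action of the semidirect product on its normal subgroup. -/
def affHom : Multiplicative (ZMod p) ⋊[φ] Multiplicative (ZMod d) →*
    Equiv.Perm (Multiplicative (ZMod p)) where
  toFun g := (φ g.right).toEquiv.trans (Equiv.mulLeft g.left)
  map_one' := by ext x; simp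
  map_mul' g h := by ext x; simp

/-- The permutation representation on `ZMod p`, in coordinates. -/
def permRep (F : Type*) [Field F] (e : Fin p ≃ Multiplicative (ZMod p)) :
    Representation F (Multiplicative (ZMod p) ⋊[φ] Multiplicative (ZMod d)) (Fin p → F) where
  toFun g := LinearMap.funLeft F F fun i => e.symm ((affHom φ g)⁻¹ (e i))
  map_one' := by ext; simp [LinearMap.funLeft]
  map_mul' g h := by ext; simp [LinearMap.funLeft]

lemma permRep_apply (F : Type*) [Field F] (e : Fin p ≃ Multiplicative (ZMod p))
    (g : Multiplicative (ZMod p) ⋊[φ] Multiplicative (ZMod d)) (u : Fin p → F) (i : Fin p) :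
    permRep φ F e g u i = u (e.symm ((affHom φ g)⁻¹ (e i))) := rfl

/-- Restriction of polynomials to the line spanned by `v`. -/
noncomputable def lineRes {F : Type*} [Field F] {n : ℕ} (v : Fin n → F) :
    MvPolynomial (Fin n) F →ₐ[F] Polynomial F :=
  aeval fun i => Polynomial.C (v i) * Polynomial.X

lemma lineRes_homog {F : Type*} [Field F] {n k : ℕ} (v : Fin n → F) {f : MvPolynomial (Fin n) F}
    (hf : f.IsHomogeneous k) :
    lineRes v f = Polynomial.C (eval v f) * Polynomial.X ^ k := by
  rw [lineRes, aeval_def, eval₂_eq, eval_eq, map_sum, Finset.sum_mul]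
  refine Finset.sum_congr rfl fun m hm => ?_
  have hm' : ∑ i ∈ m.support, m i = k := by
    have := hf.degree_eq_sum_deg_support hm
    rw [this]
  simp only [mul_pow, Finset.prod_mul_distrib, map_mul, map_prod, map_pow]
  rw [Finset.prod_pow_eq_pow_sum, hm', ← mul_assoc]
  rfl

lemma eval_smul_homog {F : Type*} [Field F] {n k : ℕ} (v : Fin n → F) (c : F)
    {f : MvPolynomial (Fin n) F} (hf : f.IsHomogeneous k) :
    eval (c • v) f = c ^ k * eval v f := by
  rw [eval_eq, eval_eq, Finset.mul_sum]
  refine Finset.sum_congr rfl fun m hm => ?_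
  have hm' : ∑ i ∈ m.support, m i = k := by
    have := hf.degree_eq_sum_deg_support hm
    rw [this]
  simp only [Pi.smul_apply, smul_eq_mul, mul_pow, Finset.prod_mul_distrib]
  rw [Finset.prod_pow_eq_pow_sum, hm']
  ring

lemma lower {F : Type*} [Field F] [IsAlgClosed F] (hp : p.Prime) (hpF : (p : F) ≠ 0)
    (e : Fin p ≃ Multiplicative (ZMod p)) (D : ℕ)
    (h : fgOver (invRing (permRep φ F e)) (Algebra.adjoin F
      (⋃ i ∈ Set.Iic D, (subComp (invRing (permRep φ F e)) i :
        Set (MvPolynomial (Fin p) F))))) : p ≤ D := by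
  by_contra hD
  push Not at hD
  have : Infinite F := IsAlgClosed.instInfinite
  have : NeZero p := ⟨hp.ne_zero⟩
  have : Fact p.Prime := ⟨hp⟩
  obtain ⟨ψ, hψ⟩ := exists_char F hpF
  let v : Fin p → F := fun i => ψ (Multiplicative.toAdd (e i))
  have hv : ∀ a : ZMod p, permRep φ F e (SemidirectProduct.inl (Multiplicative.ofAdd a)) v
      = ψ (-a) • v := by
    intro a
    ext i
    rw [permRep_apply]
    have : (affHom φ (SemidirectProduct.inl (Multiplicative.ofAdd a)))⁻¹ (e i)
        = Multiplicative.ofAdd (-a) * e i := by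
      rw [Equiv.Perm.inv_eq_iff_eq]
      simp [affHom]
    rw [this]
    simp [v, AddChar.map_add_eq_mul]
  have hvp : ∀ i, v i ^ p = 1 := by
    intro i
    simp only [v]
    rw [← AddChar.map_nsmul_eq_pow]
    simp
  have hψ1 : ∀ k, 0 < k → k < p → ψ (-1) ^ k ≠ 1 := by
    intro k hk hkp h1
    rw [← AddChar.map_nsmul_eq_pow] at h1
    have hk0 : (-(k : ZMod p)) ≠ 0 := by
      rw [neg_ne_zero, Ne, ZMod.natCast_eq_zero_iff]
      exact Nat.not_dvd_of_pos_of_lt hk hkp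
    apply hψ hk0
    ext x
    rw [AddChar.mulShift_apply]
    have : -(k : ZMod p) * x = x.val • (k • (-1 : ZMod p)) := by
      simp [mul_comm]
    rw [this, AddChar.map_nsmul_eq_pow, h1]
    simp
  -- low degree invariants are constant on the line
  have hT : ∀ t ∈ Algebra.adjoin F (⋃ i ∈ Set.Iic D, (subComp (invRing (permRep φ F e)) i :
        Set (MvPolynomial (Fin p) F))), ∃ c : F, lineRes v t = Polynomial.C c := by
    have hle : Algebra.adjoin F (⋃ i ∈ Set.Iic D, (subComp (invRing (permRep φ F e)) i :
        Set (MvPolynomial (Fin p) F))) ≤ (⊥ : Subalgebra F (Polynomial F)).comap (lineRes v) := by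
      apply Algebra.adjoin_le
      intro f hf
      simp only [Set.mem_iUnion] at hf
      obtain ⟨k, hk, hf⟩ := hf
      have hkp : k < p := lt_of_le_of_lt hk hD
      rw [SetLike.mem_coe, Subalgebra.mem_comap, lineRes_homog v hf.2, Algebra.mem_bot]
      rcases Nat.eq_zero_or_pos k with rfl | hk0
      · exact ⟨eval v f, by simp⟩
      · refine ⟨0, ?_⟩
        have h1 := (mem_invRing_iff _ f).1 hf.1
          (SemidirectProduct.inl (Multiplicative.ofAdd 1)) v
        rw [hv, eval_smul_homog v _ hf.2] at h1
        have h2 : eval v f = 0 := by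
          by_contra hne
          exact hψ1 k hk0 hkp (mul_right_cancel₀ hne (by rw [h1, one_mul]))
        simp [h2]
    intro t ht
    have := hle ht
    rw [Subalgebra.mem_comap, Algebra.mem_bot] at this
    obtain ⟨c, hc⟩ := this
    exact ⟨c, hc.symm⟩
  obtain ⟨B, -, hB⟩ := h
  let N := B.sup fun b => (lineRes v b).natDegree
  have hspan : ∀ b ∈ Submodule.span F (B : Set (MvPolynomial (Fin p) F)),
      lineRes v b ∈ Polynomial.degreeLE F N := by
    intro b hb
    have : Submodule.span F (B : Set (MvPolynomial (Fin p) F)) ≤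
        (Polynomial.degreeLE F N).comap (lineRes v).toLinearMap := by
      rw [Submodule.span_le]
      intro b hb
      rw [SetLike.mem_coe, Submodule.mem_comap, Polynomial.mem_degreeLE]
      refine Polynomial.degree_le_natDegree.trans ?_
      exact_mod_cast Finset.le_sup (f := fun b => (lineRes v b).natDegree) hb
    exact this hb
  have hall : ∀ s ∈ invRing (permRep φ F e), lineRes v s ∈ Polynomial.degreeLE F N := by
    intro s hs
    refine Submodule.mul_induction_on (hB hs)
      (C := fun s => lineRes v s ∈ Polynomial.degreeLE F N) ?_ ?_
    · intro t ht b hb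
      obtain ⟨c, hc⟩ := hT t ht
      rw [map_mul, hc, ← Polynomial.smul_eq_C_mul]
      exact Submodule.smul_mem _ _ (hspan b hb)
    · intro x y hx hy
      rw [map_add]; exact Submodule.add_mem _ hx hy
  let f : MvPolynomial (Fin p) F := ∑ i, X i ^ (p * (N + 1))
  have hf : f ∈ invRing (permRep φ F e) := by
    rw [mem_invRing_iff]
    intro g u
    simp only [f, map_sum, map_pow, eval_X, permRep_apply]
    exact Fintype.sum_equiv ((e.trans (affHom φ g)⁻¹).trans e.symm) _ _ fun i => rfl
  have hf2 : lineRes v f = Polynomial.C (p : F) * Polynomial.X ^ (p * (N + 1)) := by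
    have hh : f.IsHomogeneous (p * (N + 1)) :=
      IsHomogeneous.sum _ _ _ fun i _ => isHomogeneous_X_pow i _
    rw [lineRes_homog v hh]
    simp [f, pow_mul, hvp]
  have h3 := hall f hf
  rw [hf2, Polynomial.mem_degreeLE, Polynomial.degree_C_mul_X_pow _ hpF] at h3
  have h4 : p * (N + 1) ≤ N := by exact_mod_cast h3
  have := hp.two_le
  nlinarith

end Lower

/-- For `G = Z_p ⋊ Z_d` with `p` prime, `d ∣ p - 1` and `Z_d` acting faithfully on `Z_p`,
over an algebraically closed field of characteristic not dividing `|G| = pd`, `σ(G) = p`. -/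
theorem sigmaGrp_semidirect_eq_p {F : Type*} [Field F] [IsAlgClosed F] {p d : ℕ}
    (hp : p.Prime) (hd : d ∣ p - 1)
    (φ : Multiplicative (ZMod d) →* MulAut (Multiplicative (ZMod p)))
    (hφ : Function.Injective φ) (hF : ((p * d : ℕ) : F) ≠ 0) :
    (∀ (n : ℕ)
        (ρ : Representation F (Multiplicative (ZMod p) ⋊[φ] Multiplicative (ZMod d))
          (Fin n → F)), sigmaAlg (invRing ρ) ≤ p) ∧
      ∃ (n : ℕ)
        (ρ : Representation F (Multiplicative (ZMod p) ⋊[φ] Multiplicative (ZMod d))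
          (Fin n → F)), sigmaAlg (invRing ρ) = p := by
  have hpF : (p : F) ≠ 0 := by intro h; apply hF; simp [h]
  have hdF : (d : F) ≠ 0 := by intro h; apply hF; simp [h]
  have hd0 : d ≠ 0 := by rintro rfl; simp at hdF
  have : NeZero d := ⟨hd0⟩
  have : NeZero p := ⟨hp.ne_zero⟩
  let _ : Fintype (Multiplicative (ZMod p) ⋊[φ] Multiplicative (ZMod d)) :=
    Fintype.ofEquiv _ (SemidirectProduct.equivProd (φ := φ)).symm
  have hG : (Fintype.card (Multiplicative (ZMod p) ⋊[φ] Multiplicative (ZMod d)) : F) ≠ 0 := by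
    rw [← Nat.card_eq_fintype_card, SemidirectProduct.card]
    simpa using hF
  have hfg : ∀ (n : ℕ)
      (ρ : Representation F (Multiplicative (ZMod p) ⋊[φ] Multiplicative (ZMod d))
        (Fin n → F)), p ∈ {d : ℕ | fgOver (invRing ρ) (Algebra.adjoin F
          (⋃ i ∈ Set.Iic d, (subComp (invRing ρ) i : Set (MvPolynomial (Fin n) F))))} := by
    intro n ρ
    exact fgOver_of_sep hG ρ p (key_sep φ hp hd hφ hF ρ)
  refine ⟨fun n ρ => Nat.sInf_le (hfg n ρ), p, ?_⟩
  have hcard : Fintype.card (Multiplicative (ZMod p)) = p := by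
    rw [Fintype.card_multiplicative, ZMod.card]
  let e : Fin p ≃ Multiplicative (ZMod p) := (Fintype.equivFinOfCardEq hcard).symm
  refine ⟨permRep φ F e, le_antisymm (Nat.sInf_le (hfg p _)) ?_⟩
  exact le_csInf ⟨p, hfg p _⟩ fun D hD => lower φ hp hpF e D hD
end

section
/- Let G = A ⋊ Z_2 be a semidirect product where A is a nontrivial finite abelian group on which Z_2 acts by inversion (a ↦ a^{-1}). Suppose F is algebraically closed of characteristic not dividing |G| = 2|A|. Then σ(G) = exp(A), the exponent of A; that is, σ(G,V) ≤ exp(A) for every G-module V, and there exists a G-module V with σ(G,V) = exp(A). -/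
open scoped ENNReal


open MvPolynomial

lemma polyAct_X {F : Type*} [Field F] {G : Type*} [Group G] {ι : Type*}
    [Fintype ι] [DecidableEq ι] (ρ : Representation F G (ι → F)) (g : G) (i : ι) :
    polyAct ρ g (X i) = ∑ j, (ρ g (Pi.single j 1) i) • (X j : MvPolynomial ι F) := by
  simp [polyAct]

lemma polyAct_comp {F : Type*} [Field F] {G : Type*} [Group G] {ι : Type*}
    [Fintype ι] [DecidableEq ι] (ρ : Representation F G (ι → F)) (g h : G)
    (f : MvPolynomial ι F) :
    polyAct ρ g (polyAct ρ h f) = polyAct ρ (h * g) f := by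
  have : (polyAct ρ g).comp (polyAct ρ h) = polyAct ρ (h * g) := by
    apply MvPolynomial.algHom_ext
    intro i
    simp only [AlgHom.comp_apply, polyAct_X, map_sum, map_smul, Finset.smul_sum, smul_smul]
    rw [Finset.sum_comm]
    refine Finset.sum_congr rfl fun k _ => ?_
    rw [← Finset.sum_smul]
    congr 1
    rw [map_mul, Module.End.mul_apply]
    conv_rhs => rw [LinearMap.pi_apply_eq_sum_univ (ρ h) (ρ g (Pi.single k 1))]
    simp only [Finset.sum_apply, Pi.smul_apply, smul_eq_mul]
    refine Finset.sum_congr rfl fun j _ => ?_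
    have hj : (Pi.single j (1 : F) : ι → F) = fun l => if j = l then 1 else 0 := by
      ext l
      simp [Pi.single_apply, eq_comm]
    rw [mul_comm, hj]
  exact DFunLike.congr_fun this f

lemma polyAct_one {F : Type*} [Field F] {G : Type*} [Group G] {ι : Type*}
    [Fintype ι] [DecidableEq ι] (ρ : Representation F G (ι → F)) (f : MvPolynomial ι F) :
    polyAct ρ 1 f = f := by
  have : polyAct ρ 1 = AlgHom.id F _ := by
    apply MvPolynomial.algHom_ext
    intro i
    rw [polyAct_X]
    simp [Pi.single_apply]
  rw [this]; rfl

lemma mem_invRing {F : Type*} [Field F] {G : Type*} [Group G] {ι : Type*}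
    [Fintype ι] [DecidableEq ι] (ρ : Representation F G (ι → F)) (f : MvPolynomial ι F) :
    f ∈ invRing ρ ↔ ∀ g, polyAct ρ g f = f := by
  simp [invRing, Algebra.mem_iInf]

lemma polyAct_X_homog {F : Type*} [Field F] {G : Type*} [Group G] {ι : Type*}
    [Fintype ι] [DecidableEq ι] (ρ : Representation F G (ι → F)) (g : G) 
    (i : ι) : (polyAct ρ g (X i)).IsHomogeneous 1 := by
  rw [polyAct_X]
  apply IsHomogeneous.sum
  intro j _
  rw [smul_eq_C_mul]
  simpa using (isHomogeneous_C ι (ρ g (Pi.single j 1) i)).mul (isHomogeneous_X F j)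

/-- Finiteness from a finite set of invariants over which all variables are integral. -/
lemma fgOver_of_integral {F : Type*} [Field F] {ι : Type*} [Finite ι]
    (S T : Subalgebra F (MvPolynomial ι F)) (s : Finset (MvPolynomial ι F))
    (hsS : (s : Set (MvPolynomial ι F)) ⊆ S) (hsT : (s : Set (MvPolynomial ι F)) ⊆ T)
    (hXint : ∀ i, IsIntegral (Algebra.adjoin F (s : Set (MvPolynomial ι F))) (X i : MvPolynomial ι F)) :
    fgOver S T := by
  set T0 := Algebra.adjoin F (s : Set (MvPolynomial ι F)) with hT0
  have h0S : T0 ≤ S := Algebra.adjoin_le hsS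
  have h0T : T0 ≤ T := Algebra.adjoin_le hsT
  have : Algebra.FiniteType F T0 :=
    (Subalgebra.fg_iff_finiteType T0).1 ⟨s, rfl⟩
  have : IsNoetherianRing T0 := Algebra.FiniteType.isNoetherianRing F T0
  have : Algebra.IsIntegral T0 (MvPolynomial ι F) := by
    constructor
    intro p
    induction p using MvPolynomial.induction_on with
    | C a => exact (isIntegral_algebraMap (R := T0) (A := MvPolynomial ι F) (x := algebraMap F T0 a))
    | add p q hp hq => exact hp.add hq
    | mul_X p i hp => exact hp.mul (hXint i)
  have : Algebra.FiniteType T0 (MvPolynomial ι F) :=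
    Algebra.FiniteType.of_restrictScalars_finiteType F T0 _
  have : Module.Finite T0 (MvPolynomial ι F) := Algebra.IsIntegral.finite
  let N : Submodule T0 (MvPolynomial ι F) :=
    { carrier := S
      add_mem' := fun ha hb => S.add_mem ha hb
      zero_mem' := S.zero_mem
      smul_mem' := fun c x hx => by
        rw [Subalgebra.smul_def]
        exact S.mul_mem (h0S c.2) hx }
  obtain ⟨B, hB⟩ : N.FG := IsNoetherian.noetherian N
  refine ⟨B, ?_, ?_⟩
  · intro b hb
    have : b ∈ N := hB ▸ Submodule.subset_span hb
    exact this
  · intro x hx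
    replace hx : x ∈ N := hx
    rw [← hB] at hx
    induction hx using Submodule.span_induction with
    | mem x h =>
      rw [← one_mul x]
      exact Submodule.mul_mem_mul T.one_mem (Submodule.subset_span h)
    | zero => exact zero_mem _
    | add x y _ _ hx hy => exact add_mem hx hy
    | smul a x _ hx =>
      rw [Subalgebra.smul_def, smul_eq_mul]
      have := Submodule.mul_mem_mul (show (a : MvPolynomial ι F) ∈ Subalgebra.toSubmodule T from h0T a.2) hx
      rwa [← mul_assoc, (Subalgebra.isIdempotentElem_toSubmodule T).eq] at this

lemma sum_char_eq_zero {F : Type*} [Field F] [IsAlgClosed F]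
    {A : Type*} [CommGroup A] [Finite A] [Fintype (A →* Fˣ)]
    (hA : ((Nat.card A : ℕ) : F) ≠ 0) (a : A) (ha : a ≠ 1) :
    ∑ χ : A →* Fˣ, ((χ a : Fˣ) : F) = 0 := by
  have : NeZero ((Monoid.exponent A : ℕ) : F) := by
    constructor
    intro h
    apply hA
    obtain ⟨k, hk⟩ := Group.exponent_dvd_nat_card (G := A)
    rw [hk]; push_cast; rw [h, zero_mul]
  obtain ⟨χ₀, h0⟩ := CommGroup.exists_apply_ne_one_of_hasEnoughRootsOfUnity A F ha
  have h1 : ∑ χ : A →* Fˣ, ((χ a : Fˣ) : F) = (χ₀ a : F) * ∑ χ : A →* Fˣ, ((χ a : Fˣ) : F) := by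
    rw [Finset.mul_sum]
    rw [← Equiv.sum_comp (Equiv.mulLeft χ₀)]
    simp
  have h2 : ((χ₀ a : F) - 1) * ∑ χ : A →* Fˣ, ((χ a : Fˣ) : F) = 0 := by
    linear_combination -h1
  rcases mul_eq_zero.1 h2 with h | h
  · exact absurd (Units.ext (sub_eq_zero.1 h)) h0
  · exact h

lemma upper_fg {F : Type*} [Field F] [IsAlgClosed F]
    {A : Type*} [CommGroup A] [Finite A] [Nontrivial A]
    (φ : Multiplicative (ZMod 2) →* MulAut A)
    (hφ : ∀ a : A, φ (Multiplicative.ofAdd (1 : ZMod 2)) a = a⁻¹)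
    (hF : ((2 * Nat.card A : ℕ) : F) ≠ 0)
    (n : ℕ) (ρ : Representation F (A ⋊[φ] Multiplicative (ZMod 2)) (Fin n → F)) :
    fgOver (invRing ρ) (Algebra.adjoin F (⋃ i ∈ Set.Iic (Monoid.exponent A),
      (subComp (invRing ρ) i : Set (MvPolynomial (Fin n) F)))) := by
  classical
  have hA : ((Nat.card A : ℕ) : F) ≠ 0 := by
    intro h; apply hF; push_cast; rw [h, mul_zero]
  have : NeZero ((Monoid.exponent A : ℕ) : F) := by
    constructor
    intro h
    apply hA
    obtain ⟨k, hk⟩ := Group.exponent_dvd_nat_card (G := A)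
    rw [hk]; push_cast; rw [h, zero_mul]
  let : Fintype A := Fintype.ofFinite A
  have ec := (CommGroup.monoidHom_mulEquiv_of_hasEnoughRootsOfUnity A F).some
  have : Finite (A →* Fˣ) := Finite.of_equiv A ec.symm.toEquiv
  let : Fintype (A →* Fˣ) := Fintype.ofFinite _
  set e := Monoid.exponent A with he
  have he0 : e ≠ 0 := Monoid.exponent_ne_zero_of_finite
  have he1 : e ≠ 1 := by
    rw [he, Ne, Monoid.exp_eq_one_iff]
    exact not_subsingleton A
  have he2 : 2 ≤ e := by omega
  let G := A ⋊[φ] Multiplicative (ZMod 2)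
  let t : G := SemidirectProduct.inr (Multiplicative.ofAdd (1 : ZMod 2))
  let ia : A → G := fun a => SemidirectProduct.inl a
  have htt : t * t = 1 := by
    change SemidirectProduct.inr _ * SemidirectProduct.inr _ = _
    rw [← map_mul, ← ofAdd_add, show (1 + 1 : ZMod 2) = 0 from rfl]
    simp
  have hta : ∀ a, t * ia a = ia a⁻¹ * t := by
    intro a
    have := SemidirectProduct.inl_aut (φ := φ) (Multiplicative.ofAdd (1 : ZMod 2)) a
    rw [hφ] at this
    change _ = SemidirectProduct.inl a⁻¹ * _
    rw [this, map_inv]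
    simp [t, ia]
  have hinv : ∀ f : MvPolynomial (Fin n) F, (∀ a, polyAct ρ (ia a) f = f) →
      polyAct ρ t f = f → f ∈ invRing ρ := by
    intro f h1 h2
    rw [mem_invRing]
    intro g
    rw [← SemidirectProduct.inl_left_mul_inr_right g, ← polyAct_comp]
    change polyAct ρ _ (polyAct ρ (ia g.left) f) = f
    rw [h1]
    have : g.right = 1 ∨ g.right = Multiplicative.ofAdd (1 : ZMod 2) := by
      generalize g.right = r
      revert r
      decide
    rcases this with h | h
    · rw [h, map_one, polyAct_one]
    · rw [h]; exact h2
  let x : Fin n → (A →* Fˣ) → MvPolynomial (Fin n) F := fun i χ =>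
    ∑ a : A, ((χ a⁻¹ : Fˣ) : F) • polyAct ρ (ia a) (X i)
  let y : Fin n → (A →* Fˣ) → MvPolynomial (Fin n) F := fun i χ => polyAct ρ t (x i χ)
  have hxa : ∀ i χ b, polyAct ρ (ia b) (x i χ) = ((χ b : Fˣ) : F) • x i χ := by
    intro i χ b
    simp only [x, map_sum, map_smul, polyAct_comp, Finset.smul_sum, smul_smul]
    conv_rhs => rw [← Equiv.sum_comp (Equiv.mulRight b)]
    refine Finset.sum_congr rfl fun a _ => ?_
    simp only [Equiv.coe_mulRight, ia, ← map_mul, ← Units.val_mul]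
    congr 4
    group
  have hya : ∀ i χ b, polyAct ρ (ia b) (y i χ) = ((χ b⁻¹ : Fˣ) : F) • y i χ := by
    intro i χ b
    simp only [y]
    rw [polyAct_comp, hta, ← polyAct_comp, hxa, map_smul]
  have hyt : ∀ i χ, polyAct ρ t (y i χ) = x i χ := by
    intro i χ
    simp only [y]
    rw [polyAct_comp, htt, polyAct_one]
  have hxt : ∀ i χ, polyAct ρ t (x i χ) = y i χ := fun _ _ => rfl
  have hxhom : ∀ i χ, (x i χ).IsHomogeneous 1 := by
    intro i χ
    apply IsHomogeneous.sum
    intro a _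
    rw [smul_eq_C_mul]
    simpa using (isHomogeneous_C (Fin n) ((χ a⁻¹ : Fˣ) : F)).mul (polyAct_X_homog ρ (ia a) i)
  have hyhom : ∀ i χ, (y i χ).IsHomogeneous 1 := by
    intro i χ
    simp only [y, x, map_sum, map_smul, polyAct_comp]
    apply IsHomogeneous.sum
    intro a _
    rw [smul_eq_C_mul]
    simpa using (isHomogeneous_C (Fin n) ((χ a⁻¹ : Fˣ) : F)).mul (polyAct_X_homog ρ (ia a * t) i)
  have hpow : ∀ (χ : A →* Fˣ) (b : A), ((χ b : Fˣ) : F) ^ e = 1 := by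
    intro χ b
    rw [← Units.val_pow_eq_pow_val, ← map_pow, he, Monoid.pow_exponent_eq_one]; simp
  have h1inv : ∀ i χ, x i χ * y i χ ∈ invRing ρ := by
    intro i χ
    apply hinv
    · intro a
      rw [map_mul, hxa, hya, smul_mul_smul_comm, map_inv, Units.mul_inv, one_smul]
    · rw [map_mul, hxt, hyt, mul_comm]
  have h2inv : ∀ i χ, x i χ ^ e + y i χ ^ e ∈ invRing ρ := by
    intro i χ
    apply hinv
    · intro a
      rw [map_add, map_pow, map_pow, hxa, hya, smul_pow, smul_pow, hpow, hpow, one_smul, one_smul]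
    · rw [map_add, map_pow, map_pow, hxt, hyt, add_comm]
  let s : Finset (MvPolynomial (Fin n) F) :=
    (Finset.univ.image fun p : Fin n × (A →* Fˣ) => x p.1 p.2 * y p.1 p.2) ∪
    (Finset.univ.image fun p : Fin n × (A →* Fˣ) => x p.1 p.2 ^ e + y p.1 p.2 ^ e)
  have hs1 : ∀ i χ, x i χ * y i χ ∈ s := fun i χ =>
    Finset.mem_union_left _ (Finset.mem_image.2 ⟨(i, χ), Finset.mem_univ _, rfl⟩)
  have hs2 : ∀ i χ, x i χ ^ e + y i χ ^ e ∈ s := fun i χ =>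
    Finset.mem_union_right _ (Finset.mem_image.2 ⟨(i, χ), Finset.mem_univ _, rfl⟩)
  have hs : ∀ f ∈ s, (∃ i χ, f = x i χ * y i χ) ∨ (∃ i χ, f = x i χ ^ e + y i χ ^ e) := by
    intro f hf
    rcases Finset.mem_union.1 hf with h | h
    · obtain ⟨p, -, rfl⟩ := Finset.mem_image.1 h
      exact Or.inl ⟨_, _, rfl⟩
    · obtain ⟨p, -, rfl⟩ := Finset.mem_image.1 h
      exact Or.inr ⟨_, _, rfl⟩
  refine fgOver_of_integral _ _ s ?_ ?_ ?_
  · intro f hf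
    rcases hs f hf with ⟨i, χ, rfl⟩ | ⟨i, χ, rfl⟩
    · exact h1inv i χ
    · exact h2inv i χ
  · intro f hf
    apply Algebra.subset_adjoin
    simp only [Set.mem_iUnion, Set.mem_Iic]
    rcases hs f hf with ⟨i, χ, rfl⟩ | ⟨i, χ, rfl⟩
    · exact ⟨2, he2, h1inv i χ, (hxhom i χ).mul (hyhom i χ)⟩
    · refine ⟨e, le_rfl, h2inv i χ, ?_⟩
      have h1 := (hxhom i χ).pow e
      have h2 := (hyhom i χ).pow e
      rw [one_mul] at h1 h2
      exact h1.add h2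
  · set T0 := Algebra.adjoin F (s : Set (MvPolynomial (Fin n) F)) with hT0
    have hxint : ∀ i χ, IsIntegral T0 (x i χ) := by
      intro i χ
      let u : T0 := ⟨_, Algebra.subset_adjoin (hs1 i χ)⟩
      let v : T0 := ⟨_, Algebra.subset_adjoin (hs2 i χ)⟩
      apply IsIntegral.of_pow (Nat.pos_of_ne_zero he0)
      refine ⟨Polynomial.X ^ 2 + ((Polynomial.C (-v)) * Polynomial.X + Polynomial.C (u ^ e)), ?_, ?_⟩
      · apply Polynomial.monic_X_pow_add
        exact lt_of_le_of_lt Polynomial.degree_linear_le (by norm_num)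
      · have hu : algebraMap T0 (MvPolynomial (Fin n) F) u = x i χ * y i χ := rfl
        have hv : algebraMap T0 (MvPolynomial (Fin n) F) v = x i χ ^ e + y i χ ^ e := rfl
        simp only [Polynomial.eval₂_add, Polynomial.eval₂_mul, Polynomial.eval₂_pow,
          Polynomial.eval₂_X, Polynomial.eval₂_C, map_pow, map_neg (algebraMap T0 (MvPolynomial (Fin n) F)), hu, hv]
        ring
    intro i
    have hsum : ∑ χ, x i χ = (Nat.card A : F) • X i := by
      simp only [x]
      rw [Finset.sum_comm]
      simp only [← Finset.sum_smul]
      rw [Finset.sum_eq_single 1]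
      · simp only [inv_one, map_one, Units.val_one, Finset.sum_const, Finset.card_univ, ia,
          polyAct_one]
        rw [← Nat.card_eq_fintype_card, CommGroup.card_monoidHom_of_hasEnoughRootsOfUnity]
        simp
      · intro a _ ha
        rw [sum_char_eq_zero hA a⁻¹ (inv_ne_one.2 ha), zero_smul]
      · simp
    have hX : (X i : MvPolynomial (Fin n) F) =
        algebraMap T0 _ (algebraMap F T0 (Nat.card A : F)⁻¹) * ∑ χ, x i χ := by
      rw [hsum, ← IsScalarTower.algebraMap_apply, ← Algebra.smul_def, smul_smul,
        inv_mul_cancel₀ hA, one_smul]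
    rw [hX]
    exact isIntegral_algebraMap.mul (IsIntegral.sum _ fun χ _ => hxint i χ)

/-- The weight of the coordinate `i` of the two-dimensional test module. -/
def wt {F : Type*} [Field F] {A : Type*} [CommGroup A] (χ : A →* Fˣ) (i : Fin 2) (a : A) : F :=
  if i = 0 then ((χ a : Fˣ) : F) else ((χ a⁻¹ : Fˣ) : F)

/-- The action of `ZMod 2` on coordinate indices. -/
def sh (i : Fin 2) (s : ZMod 2) : Fin 2 := if s = 0 then i else 1 - i

/-- The two-dimensional module induced from the character `χ`. -/
def indRep {F : Type*} [Field F] {A : Type*} [CommGroup A]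
    (φ : Multiplicative (ZMod 2) →* MulAut A)
    (hφ : ∀ a : A, φ (Multiplicative.ofAdd (1 : ZMod 2)) a = a⁻¹) (χ : A →* Fˣ) :
    Representation F (A ⋊[φ] Multiplicative (ZMod 2)) (Fin 2 → F) where
  toFun g :=
    { toFun := fun v i => wt χ i g.left * v (sh i g.right.toAdd)
      map_add' := fun v w => by ext i; simp [mul_add]
      map_smul' := fun c v => by ext i; simp [mul_left_comm] }
  map_one' := by
    ext v i
    fin_cases i <;> simp [wt, sh]
  map_mul' := fun g h => by
    have key : ∀ (s : Multiplicative (ZMod 2)) (b : A) (i : Fin 2),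
        wt χ i (φ s b) = wt χ (sh i s.toAdd) b := by
      intro s b i
      have : s = 1 ∨ s = Multiplicative.ofAdd (1 : ZMod 2) := by
        revert s; decide
      rcases this with rfl | rfl
      · simp [sh]
      · rw [hφ]
        fin_cases i <;> simp [wt, sh]
    have kmul : ∀ (i : Fin 2) (a b : A), wt χ i (a * b) = wt χ i a * wt χ i b := by
      intro i a b
      unfold wt
      split_ifs <;> simp [mul_comm]
    refine LinearMap.ext fun v => funext fun i => ?_
    change wt χ i (g.left * φ g.right h.left) *
        v (sh i (g.right.toAdd + h.right.toAdd)) =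
      wt χ i g.left * (wt χ (sh i g.right.toAdd) h.left *
        v (sh (sh i g.right.toAdd) h.right.toAdd))
    have hsh : ∀ (a : Fin 2) (b c : ZMod 2), sh a (b + c) = sh (sh a b) c := by decide
    rw [kmul, key, mul_assoc, hsh]

lemma indRep_apply {F : Type*} [Field F] {A : Type*} [CommGroup A]
    (φ : Multiplicative (ZMod 2) →* MulAut A)
    (hφ : ∀ a : A, φ (Multiplicative.ofAdd (1 : ZMod 2)) a = a⁻¹) (χ : A →* Fˣ)
    (g : A ⋊[φ] Multiplicative (ZMod 2)) (v : Fin 2 → F) (i : Fin 2) :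
    indRep φ hφ χ g v i = wt χ i g.left * v (sh i g.right.toAdd) := rfl

lemma lower_s18 {F : Type*} [Field F] [IsAlgClosed F]
    {A : Type*} [CommGroup A] [Finite A] [Nontrivial A]
    (φ : Multiplicative (ZMod 2) →* MulAut A)
    (hφ : ∀ a : A, φ (Multiplicative.ofAdd (1 : ZMod 2)) a = a⁻¹)
    (χ : A →* Fˣ) (hχ : orderOf χ = Monoid.exponent A) (d : ℕ) (hd : d < Monoid.exponent A) :
    ¬ fgOver (invRing (indRep φ hφ χ)) (Algebra.adjoin F (⋃ i ∈ Set.Iic d,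
      (subComp (invRing (indRep φ hφ χ)) i : Set (MvPolynomial (Fin 2) F)))) := by
  classical
  set ρ := indRep φ hφ χ with hρ
  set e := Monoid.exponent A with he
  have he0 : e ≠ 0 := Monoid.exponent_ne_zero_of_finite
  have hpow : ∀ (b : A), ((χ b : Fˣ) : F) ^ e = 1 := by
    intro b
    rw [← Units.val_pow_eq_pow_val, ← map_pow, he, Monoid.pow_exponent_eq_one]; simp
  have hX0 : ∀ a, polyAct ρ (SemidirectProduct.inl a) (X 0) =
      C ((χ a : Fˣ) : F) * (X 0 : MvPolynomial (Fin 2) F) := by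
    intro a
    rw [polyAct_X, Fin.sum_univ_two, smul_eq_C_mul, smul_eq_C_mul]
    have h1 : ρ (SemidirectProduct.inl a) (Pi.single 0 1) 0 = ((χ a : Fˣ) : F) := by
      simp [hρ, indRep_apply, wt, sh]
    have h2 : ρ (SemidirectProduct.inl a) (Pi.single 1 1) 0 = 0 := by
      simp [hρ, indRep_apply, wt, sh]
    rw [h1, h2]; simp
  have hX1 : ∀ a, polyAct ρ (SemidirectProduct.inl a) (X 1) =
      C ((χ a⁻¹ : Fˣ) : F) * (X 1 : MvPolynomial (Fin 2) F) := by
    intro a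
    rw [polyAct_X, Fin.sum_univ_two, smul_eq_C_mul, smul_eq_C_mul]
    have h1 : ρ (SemidirectProduct.inl a) (Pi.single 1 1) 1 = ((χ a⁻¹ : Fˣ) : F) := by
      simp [hρ, indRep_apply, wt, sh]
    have h2 : ρ (SemidirectProduct.inl a) (Pi.single 0 1) 1 = 0 := by
      simp [hρ, indRep_apply, wt, sh]
    rw [h1, h2]; simp
  have ht0 : polyAct ρ (SemidirectProduct.inr (Multiplicative.ofAdd (1 : ZMod 2))) (X 0) =
      (X 1 : MvPolynomial (Fin 2) F) := by
    rw [polyAct_X, Fin.sum_univ_two, smul_eq_C_mul, smul_eq_C_mul]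
    have h1 : ρ (SemidirectProduct.inr (Multiplicative.ofAdd (1 : ZMod 2))) (Pi.single 0 1) 0 = 0 := by
      simp [hρ, indRep_apply, wt, sh]
    have h2 : ρ (SemidirectProduct.inr (Multiplicative.ofAdd (1 : ZMod 2))) (Pi.single 1 1) 0 = 1 := by
      simp [hρ, indRep_apply, wt, sh]
    rw [h1, h2]; simp
  have ht1 : polyAct ρ (SemidirectProduct.inr (Multiplicative.ofAdd (1 : ZMod 2))) (X 1) =
      (X 0 : MvPolynomial (Fin 2) F) := by
    rw [polyAct_X, Fin.sum_univ_two, smul_eq_C_mul, smul_eq_C_mul]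
    have h1 : ρ (SemidirectProduct.inr (Multiplicative.ofAdd (1 : ZMod 2))) (Pi.single 1 1) 1 = 0 := by
      simp [hρ, indRep_apply, wt, sh]
    have h2 : ρ (SemidirectProduct.inr (Multiplicative.ofAdd (1 : ZMod 2))) (Pi.single 0 1) 1 = 1 := by
      simp [hρ, indRep_apply, wt, sh]
    rw [h1, h2]; simp
  have hmem : (X 0 ^ e + X 1 ^ e : MvPolynomial (Fin 2) F) ∈ invRing ρ := by
    rw [mem_invRing]
    intro g
    rw [← SemidirectProduct.inl_left_mul_inr_right g, ← polyAct_comp]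
    have h1 : polyAct ρ (SemidirectProduct.inl g.left) (X 0 ^ e + X 1 ^ e) = X 0 ^ e + X 1 ^ e := by
      rw [map_add, map_pow, map_pow, hX0, hX1, mul_pow, mul_pow, ← C_pow, ← C_pow, hpow, hpow]
      simp
    rw [h1]
    have : g.right = 1 ∨ g.right = Multiplicative.ofAdd (1 : ZMod 2) := by
      generalize g.right = r
      revert r
      decide
    rcases this with h | h
    · rw [h, map_one, polyAct_one]
    · rw [h, map_add, map_pow, map_pow, ht0, ht1, add_comm]
  -- restriction to the first coordinate axis
  let ψ : MvPolynomial (Fin 2) F →ₐ[F] Polynomial F := aeval ![Polynomial.X, 0]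
  have hψhom : ∀ (f : MvPolynomial (Fin 2) F) (k : ℕ), f.IsHomogeneous k →
      ∃ c : F, ψ f = Polynomial.C c * Polynomial.X ^ k := by
    intro f k hf
    rw [f.as_sum, map_sum]
    have : ∀ m ∈ f.support, ∃ c : F, ψ (monomial m (f.coeff m)) = Polynomial.C c * Polynomial.X ^ k := by
      intro m hm
      have hdeg := hf (mem_support_iff.1 hm)
      rw [Finsupp.weight_apply, Finsupp.sum_fintype _ _ (by simp), Fin.sum_univ_two] at hdeg
      simp only [Pi.one_apply, smul_eq_mul, mul_one] at hdeg
      simp only [ψ, aeval_monomial]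
      rw [Finsupp.prod_fintype _ _ (by simp), Fin.prod_univ_two]
      by_cases h : m 1 = 0
      · refine ⟨f.coeff m, ?_⟩
        rw [h, add_zero] at hdeg
        simp [h, hdeg]
      · exact ⟨0, by simp [h]⟩
    choose! c hc using this
    refine ⟨∑ m ∈ f.support, c m, ?_⟩
    rw [map_sum, Finset.sum_mul]
    exact Finset.sum_congr rfl hc
  have hψact : ∀ a f, ψ (polyAct ρ (SemidirectProduct.inl a) f) =
      (ψ f).comp (Polynomial.C ((χ a : Fˣ) : F) * Polynomial.X) := by
    intro a f
    have : ψ.comp (polyAct ρ (SemidirectProduct.inl a)) =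
        (Polynomial.aeval (Polynomial.C ((χ a : Fˣ) : F) * Polynomial.X)).comp ψ := by
      apply MvPolynomial.algHom_ext
      intro i
      fin_cases i
      · simp only [AlgHom.comp_apply, Fin.zero_eta, hX0]
        simp [ψ, Polynomial.algebraMap_eq, ← algebraMap_eq]
      · simp only [AlgHom.comp_apply, Fin.mk_one, hX1]
        simp [ψ]
    exact DFunLike.congr_fun this f
  have hconst : ∀ f ∈ Algebra.adjoin F (⋃ i ∈ Set.Iic d,
      (subComp (invRing ρ) i : Set (MvPolynomial (Fin 2) F))), ∃ c : F, ψ f = Polynomial.C c := by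
    intro f hf
    induction hf using Algebra.adjoin_induction with
    | mem f hf =>
      simp only [Set.mem_iUnion, Set.mem_Iic] at hf
      obtain ⟨i, hi, hfS, hfh⟩ := hf
      obtain ⟨c, hc⟩ := hψhom f i hfh
      by_cases hi0 : i = 0
      · exact ⟨c, by rw [hc, hi0]; simp⟩
      · refine ⟨0, ?_⟩
        obtain ⟨a, ha⟩ : ∃ a, (χ a) ^ i ≠ 1 := by
          by_contra! hcon
          have := orderOf_dvd_of_pow_eq_one (x := χ) (n := i) (MonoidHom.ext hcon)
          rw [hχ] at this
          have := Nat.le_of_dvd (Nat.pos_of_ne_zero hi0) this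
          omega
        have h1 := hψact a f
        rw [(mem_invRing ρ f).1 hfS, hc] at h1
        have h2 := congrArg (fun p => Polynomial.coeff p i) h1
        simp only [Polynomial.mul_comp, Polynomial.C_comp, Polynomial.X_pow_comp, mul_pow,
          ← Polynomial.C_pow, ← mul_assoc, ← Polynomial.C_mul,
          Polynomial.coeff_C_mul_X_pow, if_true] at h2
        have h3 : c * (((χ a : Fˣ) : F) ^ i - 1) = 0 := by linear_combination -h2
        rcases mul_eq_zero.1 h3 with h | h
        · rw [hc, h]; simp
        · exact absurd (Units.ext (by simpa using sub_eq_zero.1 h)) ha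
    | algebraMap r => exact ⟨r, by simp [Polynomial.algebraMap_eq]⟩
    | add f g _ _ hf hg =>
      obtain ⟨c, hc⟩ := hf
      obtain ⟨c', hc'⟩ := hg
      exact ⟨c + c', by simp [hc, hc']⟩
    | mul f g _ _ hf hg =>
      obtain ⟨c, hc⟩ := hf
      obtain ⟨c', hc'⟩ := hg
      exact ⟨c * c', by simp [hc, hc']⟩
  rintro ⟨B, hBS, hB⟩
  -- degrees in the image are bounded
  have hbound : ∃ N : ℕ, ∀ b ∈ B, (ψ b).natDegree ≤ N :=
    ⟨B.sup fun b => (ψ b).natDegree, fun b hb => Finset.le_sup (f := fun b => (ψ b).natDegree) hb⟩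
  obtain ⟨N, hN⟩ := hbound
  have hspan : ∀ b ∈ Submodule.span F (B : Set (MvPolynomial (Fin 2) F)), (ψ b).natDegree ≤ N := by
    intro b hb
    induction hb using Submodule.span_induction with
    | mem x h => exact hN x h
    | zero => simp
    | add x y _ _ hx hy =>
      rw [map_add]
      exact (Polynomial.natDegree_add_le _ _).trans (max_le hx hy)
    | smul a x _ hx =>
      rw [map_smul]
      exact (Polynomial.natDegree_smul_le _ _).trans hx
  have hall : ∀ f ∈ invRing ρ, (ψ f).natDegree ≤ N := by
    intro f hf
    replace hf := hB hf
    induction hf using Submodule.mul_induction_on' with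
    | mem_mul_mem m hm b hb =>
      obtain ⟨c, hc⟩ := hconst m hm
      rw [map_mul, hc]
      exact (Polynomial.natDegree_C_mul_le _ _).trans (hspan b hb)
    | add x _ y _ hx hy =>
      rw [map_add]
      exact (Polynomial.natDegree_add_le _ _).trans (max_le hx hy)
  have hlast := hall _ ((invRing ρ).pow_mem hmem (N + 1))
  have : ψ ((X 0 ^ e + X 1 ^ e) ^ (N + 1)) = Polynomial.X ^ (e * (N + 1)) := by
    simp [ψ, he0, pow_mul]
  rw [this, Polynomial.natDegree_X_pow] at hlast
  have : 1 * (N + 1) ≤ e * (N + 1) := Nat.mul_le_mul_right _ (Nat.pos_of_ne_zero he0)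
  omega

/-- For `G = A ⋊ Z_2` with `A` a nontrivial finite abelian group on which `Z_2` acts by
inversion, over an algebraically closed field of characteristic not dividing `|G| = 2|A|`,
`σ(G) = exp(A)`. -/
theorem sigmaGrp_semidirect_inversion_eq_exponent {F : Type*} [Field F] [IsAlgClosed F]
    {A : Type*} [CommGroup A] [Finite A] [Nontrivial A]
    (φ : Multiplicative (ZMod 2) →* MulAut A)
    (hφ : ∀ a : A, φ (Multiplicative.ofAdd (1 : ZMod 2)) a = a⁻¹)
    (hF : ((2 * Nat.card A : ℕ) : F) ≠ 0) :
    (∀ (n : ℕ) (ρ : Representation F (A ⋊[φ] Multiplicative (ZMod 2)) (Fin n → F)),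
        sigmaAlg (invRing ρ) ≤ Monoid.exponent A) ∧
      ∃ (n : ℕ) (ρ : Representation F (A ⋊[φ] Multiplicative (ZMod 2)) (Fin n → F)),
        sigmaAlg (invRing ρ) = Monoid.exponent A := by
  have hA : ((Nat.card A : ℕ) : F) ≠ 0 := by
    intro h; apply hF; push_cast; rw [h, mul_zero]
  have : NeZero ((Monoid.exponent A : ℕ) : F) := by
    constructor
    intro h
    apply hA
    obtain ⟨k, hk⟩ := Group.exponent_dvd_nat_card (G := A)
    rw [hk]; push_cast; rw [h, zero_mul]
  have hup := fun (n : ℕ) (ρ : Representation F (A ⋊[φ] Multiplicative (ZMod 2)) (Fin n → F)) =>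
    upper_fg φ hφ hF n ρ
  refine ⟨fun n ρ => Nat.sInf_le (hup n ρ), ?_⟩
  have ec := (CommGroup.monoidHom_mulEquiv_of_hasEnoughRootsOfUnity A F).some
  obtain ⟨a, ha⟩ := Monoid.exists_orderOf_eq_exponent (Monoid.ExponentExists.of_finite (G := A))
  have hχ : orderOf (ec.symm a) = Monoid.exponent A := by
    rw [← ha]; exact ec.symm.orderOf_eq a
  refine ⟨2, indRep φ hφ (ec.symm a), le_antisymm (Nat.sInf_le (hup _ _)) ?_⟩
  refine le_csInf ⟨_, hup _ _⟩ fun d hd => ?_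
  by_contra! hlt
  exact lower_s18 φ hφ (ec.symm a) hχ d hlt hd
end
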